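/- For n ≥ 2, the K-loop (L_G, ∘) of positive definite hermitian n×n complex matrices of determinant 1, with operation given by the polar decomposition AB = (A∘B)u, u ∈ SU(n), is a simple loop: its only normal subloops are {I_n} and L_G. -/

import Mathlib

/-- A loop: a binary operation with two-sided identity whose left and right
translations are bijections. -/
structure LoopStr (L : Type*) where
  mul : L → L → L
  one : L
  one_mul : ∀ x, mul one x = x
  mul_one : ∀ x, mul x one = x
  mul_left_bij : ∀ x, Function.Bijective (mul x)
  mul_right_bij : ∀ x, Function.Bijective fun y => mul y x

/-- Left translation `λ_x` as a permutation. -/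
noncomputable def LoopStr.lam {L : Type*} (S : LoopStr L) (x : L) : Equiv.Perm L :=
  Equiv.ofBijective _ (S.mul_left_bij x)

/-- Right translation `ρ_x` as a permutation. -/
noncomputable def LoopStr.rho {L : Type*} (S : LoopStr L) (x : L) : Equiv.Perm L :=
  Equiv.ofBijective _ (S.mul_right_bij x)

/-- The left multiplication group `Mlt_ℓ(L)`. -/
noncomputable def LoopStr.Mlt {L : Type*} (S : LoopStr L) : Subgroup (Equiv.Perm L) :=
  Subgroup.closure (Set.range S.lam)

/-- Left division: `ldiv a b` is the unique solution `x` of `a·x = b`. -/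
noncomputable def LoopStr.ldiv {L : Type*} (S : LoopStr L) (a b : L) : L := (S.lam a).symm b

/-- Right division: `rdiv a b` is the unique solution `x` of `x·b = a`. -/
noncomputable def LoopStr.rdiv {L : Type*} (S : LoopStr L) (a b : L) : L := (S.rho b).symm a

/-- The inner mapping `δ_{x,y} = λ_{xy}⁻¹ ∘ λ_x ∘ λ_y`. -/
noncomputable def LoopStr.delta {L : Type*} (S : LoopStr L) (x y : L) : Equiv.Perm L :=
  (S.lam (S.mul x y))⁻¹ * S.lam x * S.lam y

/-- A loop homomorphism: preserves the multiplication and the identity. -/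
def IsLoopHom {L L' : Type*} (S : LoopStr L) (S' : LoopStr L') (θ : L → L') : Prop :=
  θ S.one = S'.one ∧ ∀ x y, θ (S.mul x y) = S'.mul (θ x) (θ y)

/-- A subloop: a subset containing the identity, closed under multiplication
and both divisions. -/
def IsSubloop {L : Type*} (S : LoopStr L) (N : Set L) : Prop :=
  S.one ∈ N ∧ (∀ a ∈ N, ∀ b ∈ N, S.mul a b ∈ N) ∧
    (∀ a ∈ N, ∀ b ∈ N, S.ldiv a b ∈ N) ∧ (∀ a ∈ N, ∀ b ∈ N, S.rdiv a b ∈ N)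

/-- A normal subloop: `ab·N = a·(bN) = (aN)·b` for all `a, b`. -/
def IsNormalSubloop {L : Type*} (S : LoopStr L) (N : Set L) : Prop :=
  IsSubloop S N ∧ ∀ a b : L,
    ((fun n => S.mul (S.mul a b) n) '' N = (fun n => S.mul a (S.mul b n)) '' N) ∧
    ((fun n => S.mul (S.mul a b) n) '' N = (fun n => S.mul (S.mul a n) b) '' N)

open scoped ComplexOrder

/-- The special unitary group `SU(n)`, as a set of matrices. -/
def SU (n : ℕ) : Set (Matrix (Fin n) (Fin n) ℂ) :=
  {u | u ∈ Matrix.unitaryGroup (Fin n) ℂ ∧ u.det = 1}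

/-- The positive definite hermitian complex `n × n` matrices of determinant 1,
as a type. -/
def LGt (n : ℕ) : Type :=
  {A : Matrix (Fin n) (Fin n) ℂ // A.PosDef ∧ A.det = 1}

/-- The underlying matrix of an element of `LGt n`. -/
def LGt.mat {n : ℕ} (A : LGt n) : Matrix (Fin n) (Fin n) ℂ := A.val

open Matrix Matrix.SpecialLinearGroup

namespace Matrix.SpecialLinearGroup

variable {ι F : Type*} [DecidableEq ι] [Fintype ι] [Field F]

lemma diag2n_eq_transvection_prod {i j : ι} (hij : i ≠ j) {c : F} (hc : c ≠ 0) :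
    diag2n hij c hc =
      transvection hij c * transvection hij.symm (-c⁻¹) * transvection hij c *
        (transvection hij (-1) * transvection hij.symm 1 * transvection hij (-1)) := by
  have hdiag : (diag2n hij c hc).1 = 1 + single i i (c - 1) + single j j (c⁻¹ - 1) := by
    ext k l
    rw [diag2n_coe]
    simp only [diagonal_apply, add_apply, one_apply, single_apply]
    grind
  apply Subtype.ext
  rw [hdiag]
  simp only [coe_mul, transvection_coe, mul_add, add_mul, mul_one, one_mul,
    single_mul_single_same, single_mul_single_of_ne _ _ _ _ hij,
    single_mul_single_of_ne _ _ _ _ hij.symm, add_zero]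
  ext k l
  obtain ⟨δ, hδ⟩ : ∃ δ : ι → ι → F, ∀ a b x, single a b x k l = x * δ a b :=
    ⟨fun a b => if a = k ∧ b = l then 1 else 0, by simp [single_apply]⟩
  simp only [add_apply, hδ]
  field_simp
  ring

/-- A subgroup of `SL(ι, F)` containing all transvections is the whole group. -/
lemma eq_top_of_transvection_mem [Nontrivial ι] (H : Subgroup (SpecialLinearGroup ι F))
    (h : ∀ (i j : ι) (hij : i ≠ j) (b : F), transvection hij b ∈ H) : H = ⊤ := by
  refine (Subgroup.eq_top_iff' H).2 fun g => ?_
  refine diagonal_transvection_induction' (· ∈ H) g (fun i j hij c hc => ?_) h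
    fun A B => H.mul_mem
  rw [diag2n_eq_transvection_prod]
  exact H.mul_mem (H.mul_mem (H.mul_mem (h ..) (h ..)) (h ..))
    (H.mul_mem (H.mul_mem (h ..) (h ..)) (h ..))

lemma diagonal_mul_transvection {D : SpecialLinearGroup ι F} {d : ι → F}
    (hD : D.1 = diagonal d) {i j : ι} (hij : i ≠ j) (hj : d j ≠ 0) (b : F) :
    D * transvection hij b = transvection hij (d i / d j * b) * D := by
  apply Subtype.ext
  ext k l
  simp only [coe_mul, transvection_coe, hD, diagonal_mul, mul_diagonal, add_apply, one_apply,
    single_apply]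
  by_cases hkl : k = l
  · subst hkl
    have : ¬ (i = k ∧ j = k) := fun h => hij (h.1.trans h.2.symm)
    simp [this]
  · by_cases h : i = k ∧ j = l
    · obtain ⟨rfl, rfl⟩ := h
      simp [hkl]
      field_simp
    · simp [h, hkl]

lemma transvection_commutator {i j k : ι} (hij : i ≠ j) (hjk : j ≠ k) (hik : i ≠ k) (b : F) :
    transvection hij b * transvection hjk 1 * (transvection hij b)⁻¹ * (transvection hjk 1)⁻¹ =
      transvection hik b := by
  rw [mul_inv_eq_iff_eq_mul, mul_inv_eq_iff_eq_mul]
  apply Subtype.ext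
  simp only [coe_mul, transvection_coe, mul_add, add_mul, mul_one, one_mul,
    single_mul_single_same, single_mul_single_of_ne _ _ _ _ hjk.symm,
    single_mul_single_of_ne _ _ _ _ hik.symm, add_zero]
  abel

/-- A normal subgroup of `SL(ι, F)` containing a non-scalar diagonal matrix is the whole group. -/
lemma normal_eq_top_of_diagonal_mem [Nontrivial ι] (M : Subgroup (SpecialLinearGroup ι F))
    [hM : M.Normal] {D : SpecialLinearGroup ι F} (hDM : D ∈ M) {d : ι → F}
    (hD : D.1 = diagonal d) {i₀ j₀ : ι} (hne : d i₀ ≠ d j₀) : M = ⊤ := by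
  have hd : ∀ j, d j ≠ 0 := fun j => diagonal_neZero d (hD ▸ D.2) j
  have key : ∀ (i j : ι) (hij : i ≠ j) (b : F), d i ≠ d j → transvection hij b ∈ M := by
    intro i j hij b h
    have hsub : d i - d j ≠ 0 := sub_ne_zero.2 h
    set t := transvection hij (b / (d i / d j - 1)) with ht
    have h0 : d i / d j - 1 ≠ 0 := by
      rw [div_sub_one (hd j)]
      exact div_ne_zero hsub (hd j)
    have : D * (t * D⁻¹ * t⁻¹) = transvection hij b := by
      rw [← mul_assoc, ← mul_assoc, ht, diagonal_mul_transvection hD hij (hd j),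
        mul_assoc _ D, mul_inv_cancel, mul_one, transvection_inv, ← transvection_add]
      congr 1
      field_simp
      ring
    rw [← this]
    exact M.mul_mem hDM (hM.conj_mem _ (M.inv_mem hDM) t)
  refine eq_top_of_transvection_mem M fun i j hij b => ?_
  by_cases h : d i = d j
  · obtain ⟨k, hk⟩ : ∃ k, d k ≠ d i := by
      by_contra! hall
      exact hne ((hall i₀).trans (hall j₀).symm)
    have hik : i ≠ k := fun e => hk (e ▸ rfl)
    have hkj : k ≠ j := fun e => hk (by rw [e, h])
    rw [← transvection_commutator hik hkj hij b, mul_assoc, mul_assoc]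
    refine M.mul_mem (key _ _ _ _ hk.symm) ?_
    rw [← mul_assoc]
    exact hM.conj_mem _ (M.inv_mem (key _ _ _ _ hk.symm)) _
  · exact key i j hij b h

end Matrix.SpecialLinearGroup

open scoped MatrixOrder Matrix.Norms.L2Operator

namespace LGt

variable {n : ℕ}

lemma posDef (A : LGt n) : A.mat.PosDef := A.2.1

lemma det_mat (A : LGt n) : A.mat.det = 1 := A.2.2

lemma ext {A B : LGt n} (h : A.mat = B.mat) : A = B := Subtype.ext h

/-- A positive definite matrix of determinant `1` as an element of `SL(n, ℂ)`. -/
def toSL (A : LGt n) : SpecialLinearGroup (Fin n) ℂ := ⟨A.mat, A.det_mat⟩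

lemma isUnit_coe (g : SpecialLinearGroup (Fin n) ℂ) : IsUnit g.1 :=
  (isUnit_iff_isUnit_det _).2 (by simp [g.2])

/-- `SL(n, ℂ)` acts on positive definite matrices of determinant `1` by `g • P = g P gᴴ`. -/
instance : MulAction (SpecialLinearGroup (Fin n) ℂ) (LGt n) where
  smul g P := ⟨g.1 * P.mat * g.1ᴴ,
    (isUnit_coe g).posDef_star_right_conjugate_iff.2 P.posDef, by
    rw [det_mul, det_mul, det_conjTranspose, g.2, P.det_mat]
    simp⟩
  one_smul P := ext (by
    change (1 : Matrix _ _ ℂ) * P.mat * (1 : Matrix _ _ ℂ)ᴴ = _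
    simp)
  mul_smul g h P := ext (by
    change (g.1 * h.1) * P.mat * (g.1 * h.1)ᴴ = g.1 * (h.1 * P.mat * h.1ᴴ) * g.1ᴴ
    simp only [conjTranspose_mul, mul_assoc])

lemma mat_smul (g : SpecialLinearGroup (Fin n) ℂ) (P : LGt n) :
    (g • P).mat = g.1 * P.mat * g.1ᴴ := rfl

/-- The square of a positive definite matrix of determinant `1`. -/
def sq (A : LGt n) : LGt n := ⟨A.mat * A.mat, by
  have := A.posDef.isUnit.posDef_star_right_conjugate_iff (x := 1)
  have h := this.2 PosDef.one
  rwa [mul_one, star_eq_conjTranspose, A.posDef.isHermitian.eq] at h, by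
  rw [det_mul, A.det_mat, mul_one]⟩

lemma mat_sq (A : LGt n) : A.sq.mat = A.mat * A.mat := rfl

lemma sq_bijective : Function.Bijective (sq : LGt n → LGt n) := by
  constructor
  · intro A B h
    have h' : A.mat * A.mat = B.mat * B.mat := congrArg mat h
    apply ext
    rw [← CFC.sqrt_mul_self A.mat A.posDef.posSemidef.nonneg, h',
      CFC.sqrt_mul_self B.mat B.posDef.posSemidef.nonneg]
  · intro Q
    have hdet : (CFC.sqrt Q.mat).det = 1 := by
      rw [Q.posDef.posSemidef.det_sqrt, Q.det_mat]
      simp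
    have hpos : (CFC.sqrt Q.mat).PosSemidef := (CFC.sqrt_nonneg Q.mat).posSemidef
    refine ⟨⟨CFC.sqrt Q.mat, ?_, hdet⟩, ext ?_⟩
    · exact hpos.posDef_iff_isUnit.2 ((isUnit_iff_isUnit_det _).2 (by simp [hdet]))
    · exact CFC.sqrt_mul_sqrt_self Q.mat Q.posDef.posSemidef.nonneg

/-- A positive definite matrix of determinant `1` is diagonalized by a conjugation
in `SL(n, ℂ)`. -/
lemma exists_conj_eq_diagonal (hn : n ≠ 0) (A : LGt n) :
    ∃ g : SpecialLinearGroup (Fin n) ℂ,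
      (g * A.toSL * g⁻¹).1 = diagonal (fun i => (A.posDef.isHermitian.eigenvalues i : ℂ)) := by
  have hA := A.posDef.isHermitian
  set U := hA.eigenvectorUnitary
  set V : Matrix (Fin n) (Fin n) ℂ := star (U : Matrix (Fin n) (Fin n) ℂ)
  have hVU : V * (U : Matrix (Fin n) (Fin n) ℂ) = 1 := Unitary.coe_star_mul_self U
  have hdet : V.det ≠ 0 := by
    intro h
    simpa [h] using congrArg det hVU
  obtain ⟨ζ, hζ⟩ := IsAlgClosed.exists_pow_nat_eq (V.det)⁻¹ (Nat.pos_of_ne_zero hn)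
  refine ⟨⟨ζ • V, ?_⟩, ?_⟩
  · rw [det_smul, Fintype.card_fin, hζ, inv_mul_cancel₀ hdet]
  · set g : SpecialLinearGroup (Fin n) ℂ := ⟨ζ • V, _⟩
    have hspec : V * A.mat * U = diagonal (fun i => (hA.eigenvalues i : ℂ)) := by
      have := hA.conjStarAlgAut_star_eigenvectorUnitary
      rw [Unitary.conjStarAlgAut_star_apply] at this
      exact this
    have hmul : (g * A.toSL).1 =
        diagonal (fun i => (hA.eigenvalues i : ℂ)) * g.1 := by
      change (ζ • V) * A.mat = _ * (ζ • V)
      rw [← hspec, Matrix.mul_smul, mul_assoc, mul_assoc, mul_eq_one_comm.1 hVU, mul_one,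
        Matrix.smul_mul]
    rw [Matrix.SpecialLinearGroup.coe_mul (g * A.toSL), hmul, mul_assoc,
      ← Matrix.SpecialLinearGroup.coe_mul, mul_inv_cancel]
    simp

/-- A positive definite matrix of determinant `1` with all eigenvalues equal is the identity. -/
lemma mat_eq_one_of_eigenvalues_eq (hn : n ≠ 0) (A : LGt n)
    (h : ∀ i j, A.posDef.isHermitian.eigenvalues i = A.posDef.isHermitian.eigenvalues j) :
    A.mat = 1 := by
  have : NeZero n := ⟨hn⟩
  have hA := A.posDef.isHermitian
  set c := hA.eigenvalues 0
  have hall : hA.eigenvalues = fun _ => c := funext fun i => h i 0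
  have hprod : c ^ n = 1 := by
    have := hA.det_eq_prod_eigenvalues
    rw [A.det_mat, hall] at this
    simp at this
    exact_mod_cast this.symm
  have hc1 : c = 1 := (pow_eq_one_iff_of_nonneg (A.posDef.eigenvalues_pos 0).le hn).1 hprod
  have := hA.spectral_theorem
  rw [this, hall, hc1, show (RCLike.ofReal ∘ fun _ => 1 : Fin n → ℂ) = 1 by ext; simp,
    Pi.one_def, diagonal_one, map_one]

/-- A subgroup of `SL(n, ℂ)` containing all positive definite matrices is the whole group. -/
lemma subgroup_eq_top (hn : 2 ≤ n) (H : Subgroup (SpecialLinearGroup (Fin n) ℂ))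
    (h : ∀ A : LGt n, A.toSL ∈ H) : H = ⊤ := by
  have : Nontrivial (Fin n) := Fin.nontrivial_iff_two_le.2 hn
  have hmem : ∀ g : SpecialLinearGroup (Fin n) ℂ, g.1.PosDef → g ∈ H :=
    fun g hg => h ⟨g.1, hg, g.2⟩
  refine eq_top_of_transvection_mem H fun i j hij b => ?_
  set D : SpecialLinearGroup (Fin n) ℂ := diag2n hij 2 two_ne_zero with hD
  have hDpos : D.1.PosDef := by
    rw [hD, diag2n_coe, posDef_diagonal_iff]
    intro k
    split_ifs <;> norm_num
  set E : SpecialLinearGroup (Fin n) ℂ := transvection hij (-b / 3) with hE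
  set E' : SpecialLinearGroup (Fin n) ℂ := ⟨E.1ᴴ, by
    rw [det_conjTranspose, E.2, star_one]⟩
  have hEDE : (E * D * E').1.PosDef := (isUnit_coe E).posDef_star_right_conjugate_iff.2 hDpos
  have hEE : (E * E').1.PosDef := by
    have := (isUnit_coe E).posDef_star_right_conjugate_iff (x := 1) |>.2 PosDef.one
    rwa [mul_one] at this
  have hprod : transvection hij b = (E * D * E') * (E * E')⁻¹ * D⁻¹ := by
    have hcomm : D * transvection hij (b / 3) = transvection hij (4 * (b / 3)) * D := by
      rw [diagonal_mul_transvection (diag2n_coe hij 2 two_ne_zero) hij (by simp [hij.symm])]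
      congr 2
      simp [hij.symm]
      norm_num
    have hE1 : E⁻¹ = transvection hij (b / 3) := by
      rw [hE, transvection_inv]
      congr 1
      ring
    have : (E * D * E') * (E * E')⁻¹ * D⁻¹ = E * (D * E⁻¹) * D⁻¹ := by group
    rw [this, hE1, hcomm, hE, ← mul_assoc, mul_inv_cancel_right, ← transvection_add]
    congr 1
    ring
  rw [hprod]
  exact H.mul_mem (H.mul_mem (hmem _ hEDE) (H.inv_mem (hmem _ hEE))) (H.inv_mem (hmem _ hDpos))

lemma sq_mul {S : LoopStr (LGt n)}
    (hmul : ∀ A B : LGt n, ∃ u ∈ SU n, A.mat * B.mat = (S.mul A B).mat * u) (A B : LGt n) :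
    (S.mul A B).sq = A.toSL • B.sq := by
  obtain ⟨u, ⟨hu, -⟩, h⟩ := hmul A B
  have huu : u * uᴴ = 1 := mem_unitaryGroup_iff.1 hu
  apply ext
  have h2 : (A.mat * B.mat) * (A.mat * B.mat)ᴴ =
      ((S.mul A B).mat * u) * ((S.mul A B).mat * u)ᴴ := by
    rw [h]
  rw [conjTranspose_mul, conjTranspose_mul, B.posDef.isHermitian.eq,
    (S.mul A B).posDef.isHermitian.eq, mul_assoc _ u, ← mul_assoc u, huu, one_mul] at h2
  rw [mat_smul, mat_sq, mat_sq, ← h2]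
  simp only [toSL, mul_assoc]

end LGt

section Fiber

variable {G X Y : Type*} [Group G] [MulAction G X]

/-- The elements of `G` whose action preserves the partition of `X` into fibers of `f`. -/
def fiberStabilizer (G : Type*) [Group G] [MulAction G X] (f : X → Y) : Subgroup G where
  carrier := {g | ∀ x y, f (g • x) = f (g • y) ↔ f x = f y}
  one_mem' x y := by simp
  mul_mem' {g h} hg hh x y := by rw [mul_smul, mul_smul, hg, hh]
  inv_mem' {g} hg x y := by rw [← hg, smul_inv_smul, smul_inv_smul]

/-- The elements of `G` whose action preserves each fiber of `f`. -/
def fiberKernel (G : Type*) [Group G] [MulAction G X] (f : X → Y) : Subgroup G where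
  carrier := {g | ∀ x, f (g • x) = f x}
  one_mem' x := by simp
  mul_mem' {g h} hg hh x := by rw [mul_smul, hg, hh]
  inv_mem' {g} hg x := by rw [← hg, smul_inv_smul]

lemma fiberKernel_normal {f : X → Y} (h : fiberStabilizer G f = ⊤) :
    (fiberKernel G f).Normal where
  conj_mem m hm g x := by
    have hg : g ∈ fiberStabilizer G f := h ▸ Subgroup.mem_top g
    have := (hg (m • g⁻¹ • x) (g⁻¹ • x)).2 (hm _)
    rwa [smul_inv_smul, ← mul_smul, ← mul_smul] at this

end Fiber

namespace IsNormalSubloop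

variable {L : Type*} {S : LoopStr L} {N : Set L}

lemma image_mul (hN : IsNormalSubloop S N) (a x : L) :
    S.mul (S.mul a x) '' N = S.mul a '' (S.mul x '' N) := by
  rw [Set.image_image]
  exact (hN.2 a x).1

lemma image_mul_eq_iff (hN : IsNormalSubloop S N) (a x y : L) :
    S.mul (S.mul a x) '' N = S.mul (S.mul a y) '' N ↔ S.mul x '' N = S.mul y '' N := by
  rw [hN.image_mul, hN.image_mul, (S.mul_left_bij a).1.image_injective.eq_iff]

lemma image_mul_of_mem (hN : IsNormalSubloop S N) {m : L} (hm : m ∈ N) :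
    S.mul m '' N = N := by
  refine Set.Subset.antisymm (Set.image_subset_iff.2 fun k hk => hN.1.2.1 m hm k hk)
    fun k hk => ⟨S.ldiv m k, hN.1.2.2.1 m hm k hk, ?_⟩
  exact (S.lam m).apply_symm_apply k

lemma image_mul_left_of_mem (hN : IsNormalSubloop S N) {m : L} (hm : m ∈ N) (x : L) :
    S.mul (S.mul m x) '' N = S.mul x '' N := by
  have h := (hN.2 S.one x).2
  simp only [S.one_mul] at h
  obtain ⟨k, hk, hkx⟩ : S.mul m x ∈ S.mul x '' N := h ▸ ⟨m, hm, rfl⟩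
  rw [← hkx, hN.image_mul, hN.image_mul_of_mem hk]

lemma mem_of_image_eq (hN : IsNormalSubloop S N) {x : L}
    (h : S.mul x '' N = S.mul S.one '' N) : x ∈ N := by
  have hx : x ∈ S.mul x '' N := ⟨S.one, hN.1.1, S.mul_one x⟩
  rwa [h, hN.image_mul_of_mem hN.1.1] at hx

end IsNormalSubloop

/-- For `n ≥ 2`, the K-loop of positive definite hermitian
`n × n` complex matrices of determinant 1 (operation from polar decomposition
in `SL(n, ℂ)`) is a simple loop: its only normal subloops are `{I_n}` and the
whole loop. -/
theorem stmt17 (n : ℕ) (hn : 2 ≤ n) (S : LoopStr (LGt n)) (hone : S.one.mat = 1)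
    (hmul : ∀ A B : LGt n, ∃ u ∈ SU n, A.mat * B.mat = (S.mul A B).mat * u) :
    ∀ N : Set (LGt n), IsNormalSubloop S N → N = {S.one} ∨ N = Set.univ := by
  intro N hN
  have : Nontrivial (Fin n) := Fin.nontrivial_iff_two_le.2 hn
  by_cases htriv : ∀ A ∈ N, A = S.one
  · exact Or.inl (Set.eq_singleton_iff_unique_mem.2 ⟨hN.1.1, htriv⟩)
  right
  push Not at htriv
  obtain ⟨A, hAN, hA⟩ := htriv
  let e := Equiv.ofBijective _ (LGt.sq_bijective (n := n))
  let f : LGt n → Set (LGt n) := fun Q => S.mul (e.symm Q) '' N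
  have hf (x : LGt n) : f x.sq = S.mul x '' N := by
    change S.mul (e.symm (e x)) '' N = _
    rw [e.symm_apply_apply]
  have hf_smul (B x : LGt n) : f (B.toSL • x.sq) = S.mul (S.mul B x) '' N := by
    rw [← LGt.sq_mul hmul, hf]
  have hH : fiberStabilizer (SpecialLinearGroup (Fin n) ℂ) f = ⊤ := by
    refine LGt.subgroup_eq_top hn _ fun B P Q => ?_
    obtain ⟨x, rfl⟩ := LGt.sq_bijective.2 P
    obtain ⟨y, rfl⟩ := LGt.sq_bijective.2 Q
    rw [hf_smul, hf_smul, hf, hf, hN.image_mul_eq_iff]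
  have := fiberKernel_normal hH
  have hAM : A.toSL ∈ fiberKernel (SpecialLinearGroup (Fin n) ℂ) f := fun P => by
    obtain ⟨x, rfl⟩ := LGt.sq_bijective.2 P
    rw [hf_smul, hf, hN.image_mul_left_of_mem hAN]
  obtain ⟨g, hg⟩ := A.exists_conj_eq_diagonal (by omega)
  obtain ⟨i, j, hij⟩ : ∃ i j,
      A.posDef.isHermitian.eigenvalues i ≠ A.posDef.isHermitian.eigenvalues j := by
    by_contra! hall
    exact hA (LGt.ext ((A.mat_eq_one_of_eigenvalues_eq (by omega) hall).trans hone.symm))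
  have hM : fiberKernel (SpecialLinearGroup (Fin n) ℂ) f = ⊤ :=
    normal_eq_top_of_diagonal_mem _ (this.conj_mem _ hAM g) hg (i₀ := i) (j₀ := j)
      (by simpa using hij)
  refine Set.eq_univ_of_forall fun B => hN.mem_of_image_eq ?_
  have hB : B.toSL ∈ fiberKernel (SpecialLinearGroup (Fin n) ℂ) f := hM ▸ Subgroup.mem_top _
  have h := hB S.one.sq
  rwa [hf_smul, hf, S.mul_one] at h
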